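/- Let G be a finite simple group with trivial 2-core (i.e., the only normal subgroup of G that is a 2-group is the trivial subgroup), and suppose G is isomorphic to the unit group of some ring. Then there exist n ≥ 1 and k ≥ 1 such that G is isomorphic to the general linear group GL_n(F_{2^k}). -/

import Mathlib

theorem aux_core {G H : Type} [Group G] [Group H] (e : G ≃* H)
    (h : ∀ N : Subgroup G, N.Normal → IsPGroup 2 N → N = ⊥) :
    ∀ N : Subgroup H, N.Normal → IsPGroup 2 N → N = ⊥ := by
  intro N hN hp
  have h1 := h (N.comap e.toMonoidHom) (hN.comap _)
    (hp.comap_of_injective e.toMonoidHom e.injective)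
  rw [eq_bot_iff]
  intro x hx
  have h2 : e.symm x ∈ N.comap e.toMonoidHom := by simpa using hx
  rw [h1, Subgroup.mem_bot] at h2
  simpa using h2

theorem aux_two {R : Type} [Ring R]
    (h : ∀ N : Subgroup Rˣ, N.Normal → IsPGroup 2 N → N = ⊥) : (2 : R) = 0 := by
  have hsq : (-1 : Rˣ) ^ 2 = 1 := by simp
  have h1 := h (Subgroup.zpowers (-1 : Rˣ)) ?_ ?_
  · have : (-1 : Rˣ) = 1 := by simpa using h1
    have h3 : (-1 : R) = 1 := by
      have := congrArg Units.val this
      simpa using this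
    calc (2 : R) = 1 + 1 := by norm_num
      _ = -1 + 1 := by rw [h3]
      _ = 0 := by simp
  · constructor
    intro n hn g
    obtain ⟨k, rfl⟩ := Subgroup.mem_zpowers_iff.1 hn
    have hc : Commute g ((-1 : Rˣ) ^ k) := Commute.zpow_right (Commute.neg_one_right g) k
    rw [hc.eq, mul_inv_cancel_right]
    exact hn
  · rintro ⟨x, hx⟩
    refine ⟨1, ?_⟩
    obtain ⟨k, rfl⟩ := Subgroup.mem_zpowers_iff.1 hx
    apply Subtype.ext
    simp only [pow_one, Subgroup.coe_pow, Subgroup.coe_one]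
    rw [← zpow_natCast, zpow_comm, zpow_natCast, hsq, one_zpow]

theorem aux_semisimple {S : Type} [Ring S] [Finite S] [CharP S 2]
    (h : ∀ N : Subgroup Sˣ, N.Normal → IsPGroup 2 N → N = ⊥) : IsSemisimpleRing S := by
  rw [IsArtinianRing.isSemisimpleRing_iff_jacobson]
  obtain ⟨n, hn⟩ := IsSemiprimaryRing.isNilpotent (R := S)
  have hnil : ∀ x ∈ Ring.jacobson S, x ^ n = 0 := by
    intro x hx
    have := Ideal.pow_mem_pow hx n
    rw [hn] at this
    simpa using this
  let f : Sˣ →* (S ⧸ Ring.jacobson S)ˣ := Units.map (Ideal.Quotient.mk (Ring.jacobson S)).toMonoidHom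
  have hf : ∀ u : Sˣ, u ∈ f.ker ↔ (u : S) - 1 ∈ Ring.jacobson S := by
    intro u
    rw [MonoidHom.mem_ker, Units.ext_iff]
    change Ideal.Quotient.mk (Ring.jacobson S) (u : S) = Ideal.Quotient.mk _ 1 ↔ _
    rw [Ideal.Quotient.eq]
  have hker := h f.ker inferInstance ?_
  · rw [eq_bot_iff]
    intro x hx
    obtain ⟨u, hu⟩ := IsNilpotent.isUnit_one_add (⟨n, hnil x hx⟩ : IsNilpotent x)
    have : u ∈ f.ker := by rw [hf, hu]; simpa using hx
    rw [hker, Subgroup.mem_bot] at this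
    subst this
    simpa using hu
  · rintro ⟨u, hu⟩
    refine ⟨n, ?_⟩
    apply Subtype.ext
    apply Units.ext
    simp only [Subgroup.coe_pow, Units.val_pow_eq_pow_val, Subgroup.coe_one, Units.val_one]
    have hx := hnil _ ((hf u).1 hu)
    have hx2 : ((u : S) - 1) ^ 2 ^ n = 0 := pow_eq_zero_of_le (Nat.lt_two_pow_self).le hx
    have h3 := add_pow_expChar_pow_of_commute (R := S) 2 n (Commute.one_right ((u : S) - 1))
    rw [hx2] at h3
    simpa using h3

theorem aux_finite {G : Type} [Group G] [IsSimpleGroup G] {S : Type} [Ring S] [Finite S]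
    [Algebra (ZMod 2) S] [IsSemisimpleRing S] (e : G ≃* Sˣ) :
    ∃ (n k : ℕ), 1 ≤ n ∧ 1 ≤ k ∧
      Nonempty (G ≃* Matrix.GeneralLinearGroup (Fin n) (GaloisField 2 k)) := by
  obtain ⟨m, D, d, _, _, hfin, hd, ⟨φ⟩⟩ :=
    IsSemisimpleRing.exists_algEquiv_pi_matrix_divisionRing_finite (ZMod 2) S
  let ψ : G ≃* (Π i, (Matrix (Fin (d i)) (Fin (d i)) (D i))ˣ) :=
    (e.trans (Units.mapEquiv φ.toMulEquiv)).trans MulEquiv.piUnits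
  obtain ⟨g, hg⟩ := exists_ne (1 : G)
  have hg' : ψ g ≠ 1 := by simpa using hg
  obtain ⟨i, hi⟩ := Function.ne_iff.1 hg'
  let p : G →* (Matrix (Fin (d i)) (Fin (d i)) (D i))ˣ :=
    (Pi.evalMonoidHom _ i).comp ψ.toMonoidHom
  have hps : Function.Surjective p :=
    (Function.surjective_eval i).comp ψ.surjective
  have hpi : Function.Injective p := by
    rw [← MonoidHom.ker_eq_bot_iff]
    rcases (inferInstance : p.ker.Normal).eq_bot_or_eq_top with h | h
    · exact h
    · exfalso
      have : g ∈ p.ker := by rw [h]; trivial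
      exact hi this
  have hFD : Finite (D i) := Module.finite_of_finite (ZMod 2)
  have hcard : Nat.card (D i) = 2 ^ Module.finrank (ZMod 2) (D i) := by
    have := Module.natCard_eq_pow_finrank (K := ZMod 2) (V := D i)
    simpa using this
  let γ : D i ≃ₐ[ZMod 2] GaloisField 2 (Module.finrank (ZMod 2) (D i)) :=
    GaloisField.algEquivGaloisField 2 _ hcard
  refine ⟨d i, Module.finrank (ZMod 2) (D i), Nat.one_le_iff_ne_zero.2 (hd i).out,
    Module.finrank_pos, ⟨(MulEquiv.ofBijective p ⟨hpi, hps⟩).trans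
      (Units.mapEquiv (γ.mapMatrix (m := Fin (d i))).toMulEquiv)⟩⟩

theorem aux_sub {R : Type} [Ring R] [Algebra (ZMod 2) R] [Finite Rˣ] :
    ∃ S : Subalgebra (ZMod 2) R, Finite S ∧ Nonempty (Rˣ ≃* Sˣ) := by
  let M : Submonoid R := MonoidHom.mrange (Units.coeHom R)
  have hM : (M : Set R).Finite := by
    have : (M : Set R) = Set.range (Units.coeHom R) := MonoidHom.coe_mrange _
    rw [this]
    exact Set.finite_range _
  let S := Algebra.adjoin (ZMod 2) (M : Set R)
  have hu : ∀ u : Rˣ, (u : R) ∈ S := fun u => Algebra.subset_adjoin ⟨u, rfl⟩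
  refine ⟨S, ?_, ?_⟩
  · have h1 : Subalgebra.toSubmodule S = Submodule.span (ZMod 2) (M : Set R) := by
      rw [Algebra.adjoin_eq_span, Submonoid.closure_eq]
    have h2 : Module.Finite (ZMod 2) (Subalgebra.toSubmodule S) := by
      rw [h1]
      exact Module.Finite.span_of_finite _ hM
    exact Module.finite_of_finite (M := Subalgebra.toSubmodule S) (ZMod 2)
  · refine ⟨(MulEquiv.ofBijective (Units.map S.val.toMonoidHom) ⟨?_, ?_⟩).symm⟩
    · exact Units.map_injective Subtype.val_injective
    · intro u
      exact ⟨⟨⟨u, hu u⟩, ⟨_, hu u⁻¹⟩, Subtype.ext (by simp), Subtype.ext (by simp)⟩,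
        Units.ext rfl⟩


/-- A finite simple group with trivial 2-core which is isomorphic to the unit group of
some ring is isomorphic to GL_n(F_{2^k}) for some n ≥ 1 and k ≥ 1. -/
theorem stmt_15 (G : Type) [Group G] [Finite G] [IsSimpleGroup G]
    (h2core : ∀ N : Subgroup G, N.Normal → IsPGroup 2 N → N = ⊥)
    (hunits : ∃ (R : Type) (_ : Ring R), Nonempty (G ≃* Rˣ)) :
    ∃ (n k : ℕ), 1 ≤ n ∧ 1 ≤ k ∧
      Nonempty (G ≃* Matrix.GeneralLinearGroup (Fin n) (GaloisField 2 k)) := by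
  obtain ⟨R, _, ⟨e⟩⟩ := hunits
  have h2 := aux_two (aux_core e h2core)
  have hne : Nontrivial R := by
    by_contra hR
    rw [not_nontrivial_iff_subsingleton] at hR
    obtain ⟨a, b, hab⟩ := exists_pair_ne G
    exact hab (e.injective (Units.ext (Subsingleton.elim _ _)))
  have hchar : CharP R 2 := CharTwo.of_one_ne_zero_of_two_eq_zero one_ne_zero h2
  letI : Algebra (ZMod 2) R := ZMod.algebra R 2
  haveI : Finite Rˣ := Finite.of_equiv G e.toEquiv
  obtain ⟨S, hS, ⟨e'⟩⟩ := aux_sub (R := R)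
  haveI : CharP S 2 := charP_of_injective_algebraMap (algebraMap (ZMod 2) S).injective 2
  haveI := aux_semisimple (aux_core (e.trans e') h2core)
  exact aux_finite (e.trans e')
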